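/- arXiv:1303.6240 — 4 statements merged into one kernel-verified Lean document; each statement's English description precedes it below -/
import Mathlib

section
/- Let (C, d, F) be a filtered complex over a commutative ring R, and let d_r : E_r^k → E_r^{k−r} denote the map induced by d on pages. Then for all integers r and k, the homology of the page (E_r, d_r) at position k is isomorphic to the next page: ker(d_r : E_r^k → E_r^{k−r}) / im(d_r : E_r^{k+r} → E_r^k) ≅ E_{r+1}^k as R-modules. -/
/-- The approximate cycles `Z_r^k = {x ∈ F^k : d x ∈ F^{k-r}}` of a filtered complex. -/
def Zrk {R : Type*} [CommRing R] {C : Type*} [AddCommGroup C] [Module R C]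
    (d : C →ₗ[R] C) (F : ℤ → Submodule R C) (r k : ℤ) : Submodule R C :=
  F k ⊓ (F (k - r)).comap d

/-- The early boundaries `B_r^k = F^k ∩ d(F^{k+r})` of a filtered complex. -/
def Brk {R : Type*} [CommRing R] {C : Type*} [AddCommGroup C] [Module R C]
    (d : C →ₗ[R] C) (F : ℤ → Submodule R C) (r k : ℤ) : Submodule R C :=
  F k ⊓ (F (k + r)).map d

/-- The denominator `Z_{r-1}^{k-1} + B_{r-1}^k` of the page `E_r^k`. -/
def Drk {R : Type*} [CommRing R] {C : Type*} [AddCommGroup C] [Module R C]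
    (d : C →ₗ[R] C) (F : ℤ → Submodule R C) (r k : ℤ) : Submodule R C :=
  Zrk d F (r - 1) (k - 1) ⊔ Brk d F (r - 1) k

/-- The page `E_r^k = Z_r^k / (Z_{r-1}^{k-1} + B_{r-1}^k)` of a filtered complex. -/
abbrev Page {R : Type*} [CommRing R] {C : Type*} [AddCommGroup C] [Module R C]
    (d : C →ₗ[R] C) (F : ℤ → Submodule R C) (r k : ℤ) :=
  ↥(Zrk d F r k) ⧸ (Drk d F r k).comap (Zrk d F r k).subtype


section FilteredComplex

variable {R : Type*} [CommRing R] {C : Type*} [AddCommGroup C] [Module R C]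
  {d : C →ₗ[R] C} {F : ℤ → Submodule R C} {r k : ℤ}

theorem Page.mk_eq_zero {x : C} (hx : x ∈ Zrk d F r k) :
    (Submodule.Quotient.mk ⟨x, hx⟩ : Page d F r k) = 0 ↔ x ∈ Drk d F r k := by
  rw [Submodule.Quotient.mk_eq_zero]
  rfl

theorem Zrk_succ_le (hmono : Monotone F) : Zrk d F (r + 1) k ≤ Zrk d F r k :=
  fun _ hx => ⟨hx.1, hmono (by lia) hx.2⟩

theorem map_Zrk_le (hd : d ∘ₗ d = 0) : (Zrk d F r (k + r)).map d ≤ Zrk d F r k := by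
  rintro _ ⟨x, hx, rfl⟩
  refine ⟨by simpa using hx.2, ?_⟩
  simp [show d (d x) = 0 from LinearMap.congr_fun hd x]

theorem map_Zrk_le_sub (hd : d ∘ₗ d = 0) : (Zrk d F r k).map d ≤ Zrk d F r (k - r) := by
  rintro _ ⟨x, hx, rfl⟩
  refine ⟨hx.2, ?_⟩
  simp [show d (d x) = 0 from LinearMap.congr_fun hd x]

/-- The approximate cycles whose boundary dies on the page `E_r` are those congruent to an element
of `Z_{r+1}^k` modulo `Z_{r-1}^{k-1}`. -/
theorem map_mem_Drk_iff (hd : d ∘ₗ d = 0) (hmono : Monotone F) {x : C} (hx : x ∈ F k) :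
    d x ∈ Drk d F r (k - r) ↔ x ∈ Zrk d F (r + 1) k ⊔ Zrk d F (r - 1) (k - 1) := by
  simp only [Drk, Submodule.mem_sup]
  constructor
  · rintro ⟨u, hu, _, ⟨hv, y, hy, rfl⟩, h⟩
    have hy' : y ∈ F (k - 1) := hmono (by lia) hy
    refine ⟨x - y, ⟨sub_mem hx (hmono (by lia) hy'), ?_⟩, y, ⟨hy', hmono (by lia) hv⟩, by simp⟩
    change d (x - y) ∈ F _
    rw [map_sub, ← h, add_sub_cancel_right]
    exact hmono (by lia) hu.1
  · rintro ⟨z, hz, y, hy, rfl⟩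
    refine ⟨d z, ⟨hmono (by lia) hz.2, ?_⟩, d y,
      ⟨hmono (by lia) hy.2, y, hmono (by lia) hy.1, rfl⟩, by simp⟩
    simp [show d (d z) = 0 from LinearMap.congr_fun hd z]

/-- The elements of `Z_{r+1}^k` that die on the page `E_{r+1}` are those congruent to a boundary
of an element of `Z_r^{k+r}` modulo `D_r^k`. -/
theorem mem_Drk_succ_iff (hd : d ∘ₗ d = 0) (hmono : Monotone F) {x : C}
    (hx : x ∈ Zrk d F (r + 1) k) :
    x ∈ Drk d F (r + 1) k ↔ ∃ y ∈ Zrk d F r (k + r), d y - x ∈ Drk d F r k := by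
  constructor
  · intro h
    obtain ⟨u, hu, _, ⟨hv, y, hy, rfl⟩, rfl⟩ := Submodule.mem_sup.1 h
    rw [add_sub_cancel_right] at hu hy
    refine ⟨y, ⟨hmono (by lia) hy, by simpa using hv⟩, ?_⟩
    rw [sub_add_cancel_right]
    exact neg_mem (Submodule.mem_sup_left ⟨hu.1, hmono (by lia) hu.2⟩)
  · rintro ⟨y, hy, h⟩
    obtain ⟨u, hu, _, ⟨hv, w, hw, rfl⟩, h⟩ := Submodule.mem_sup.1 h
    have hxe : x = -u + d (y - w) := by
      rw [map_sub, ← sub_eq_zero, ← sub_eq_zero.2 h]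
      abel
    have hyw : y - w ∈ F (k + (r + 1 - 1)) :=
      sub_mem (hmono (by lia) hy.1) (hmono (by lia) hw)
    have hdyw : d (y - w) ∈ F k := by
      rw [map_sub]
      exact sub_mem (by simpa using hy.2) hv
    have hdu : d (-u) = d x := by
      rw [hxe, map_add, show d (d (y - w)) = 0 from LinearMap.congr_fun hd _, add_zero]
    rw [hxe]
    refine add_mem (Submodule.mem_sup_left ⟨neg_mem (hmono (by lia) hu.1), ?_⟩)
      (Submodule.mem_sup_right ⟨hdyw, y - w, hyw, rfl⟩)
    change d (-u) ∈ F _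
    rw [hdu]
    exact hmono (by lia) hx.2

end FilteredComplex

/-- For a filtered complex, the homology of the page `(E_r, d_r)` at
position `k`, namely `ker(d_r : E_r^k → E_r^{k-r}) / im(d_r : E_r^{k+r} → E_r^k)`,
is isomorphic as an `R`-module to the next page `E_{r+1}^k`. -/
theorem stmt3 {R : Type*} [CommRing R] {C : Type*} [AddCommGroup C] [Module R C]
    (d : C →ₗ[R] C) (F : ℤ → Submodule R C)
    (hd : d ∘ₗ d = 0) (hmono : Monotone F) (hdF : ∀ k, (F k).map d ≤ F k)
    (r k : ℤ)
    (drA : Page d F r (k + r) →ₗ[R] Page d F r k)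
    (hA : ∀ (x : C) (hx : x ∈ Zrk d F r (k + r)) (hdx : d x ∈ Zrk d F r k),
      drA (Submodule.Quotient.mk ⟨x, hx⟩) = Submodule.Quotient.mk ⟨d x, hdx⟩)
    (drB : Page d F r k →ₗ[R] Page d F r (k - r))
    (hB : ∀ (x : C) (hx : x ∈ Zrk d F r k) (hdx : d x ∈ Zrk d F r (k - r)),
      drB (Submodule.Quotient.mk ⟨x, hx⟩) = Submodule.Quotient.mk ⟨d x, hdx⟩) :
    Nonempty
      ((↥(LinearMap.ker drB) ⧸
          (LinearMap.range drA).comap (LinearMap.ker drB).subtype) ≃ₗ[R]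
        Page d F (r + 1) k) := by
  have hker (x : C) (hx : x ∈ Zrk d F r k) :
      Submodule.Quotient.mk ⟨x, hx⟩ ∈ LinearMap.ker drB ↔
        x ∈ Zrk d F (r + 1) k ⊔ Zrk d F (r - 1) (k - 1) := by
    rw [LinearMap.mem_ker, hB x hx (map_Zrk_le_sub hd ⟨x, hx, rfl⟩), Page.mk_eq_zero,
      map_mem_Drk_iff hd hmono hx.1]
  let toKer : Zrk d F (r + 1) k →ₗ[R] LinearMap.ker drB :=
    (Submodule.mkQ _ ∘ₗ Submodule.inclusion (Zrk_succ_le hmono)).codRestrict _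
      fun x => (hker x (Zrk_succ_le hmono x.2)).2 (Submodule.mem_sup_left x.2)
  let φ := ((LinearMap.range drA).comap (LinearMap.ker drB).subtype).mkQ ∘ₗ toKer
  have hφ : Function.Surjective φ := by
    intro q
    obtain ⟨⟨p, hp⟩, rfl⟩ := Submodule.Quotient.mk_surjective _ q
    obtain ⟨⟨x, hx⟩, rfl⟩ := Submodule.Quotient.mk_surjective _ p
    obtain ⟨z, hz, y, hy, rfl⟩ := Submodule.mem_sup.1 ((hker x hx).1 hp)
    refine ⟨⟨z, hz⟩, congrArg (Submodule.mkQ _) (Subtype.ext ?_ : toKer ⟨z, hz⟩ = ⟨_, hp⟩)⟩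
    refine (Submodule.Quotient.eq _).2 ?_
    change z - (z + y) ∈ Drk d F r k
    rw [sub_add_cancel_left]
    exact neg_mem (Submodule.mem_sup_left hy)
  have hφker : LinearMap.ker φ = (Drk d F (r + 1) k).comap (Zrk d F (r + 1) k).subtype := by
    ext ⟨x, hx⟩
    rw [LinearMap.mem_ker, Submodule.mem_comap]
    refine (Submodule.Quotient.mk_eq_zero _).trans (Iff.trans ?_ (mem_Drk_succ_iff hd hmono hx).symm)
    change Submodule.Quotient.mk ⟨x, Zrk_succ_le hmono hx⟩ ∈ LinearMap.range drA ↔ _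
    constructor
    · rintro ⟨p, hp⟩
      obtain ⟨⟨y, hy⟩, rfl⟩ := Submodule.Quotient.mk_surjective _ p
      rw [hA y hy (map_Zrk_le hd ⟨y, hy, rfl⟩)] at hp
      exact ⟨y, hy, ((Submodule.Quotient.eq _).1 hp :)⟩
    · rintro ⟨y, hy, h⟩
      refine ⟨Submodule.Quotient.mk ⟨y, hy⟩, ?_⟩
      rw [hA y hy (map_Zrk_le hd ⟨y, hy, rfl⟩)]
      exact (Submodule.Quotient.eq _).2 h
  exact ⟨((Submodule.quotEquivOfEq _ _ hφker.symm).trans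
    (φ.quotKerEquivOfSurjective hφ)).symm⟩
end

section
/- Let (C, d, F) be a filtered complex over a commutative ring R whose filtration is finite, with F^k = 0 for k < a and F^k = C for k ≥ b. Fix an integer k, and let Z^k = ker d ∩ F^k and B^k = (range d) ∩ F^k. Then for every integer r > max(k − a, b − k) one has Z_r^k = Z^k and Z_{r−1}^{k−1} + B_{r−1}^k = Z^{k−1} + B^k, so that the page E_r^k equals the stable page Z^k / (Z^{k−1} + B^k); moreover this stable page is isomorphic as an R-module to 𝒢^k / 𝒢^{k−1}, where 𝒢^k denotes the submodule ((ker d ∩ F^k) + range d) / range d of the total homology H(C) = ker d / range d (that is, the image of the homology of the subcomplex F^k in H(C)). -/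
/-- The filtration `𝒢^j` on the total homology `H(C) = ker d / range d`:
the image of the homology of the subcomplex `F^j` in `H(C)`. -/
def Gfil {R : Type*} [CommRing R] {C : Type*} [AddCommGroup C] [Module R C]
    (d : C →ₗ[R] C) (F : ℤ → Submodule R C) (j : ℤ) :
    Submodule R
      (↥(LinearMap.ker d) ⧸ (LinearMap.range d).comap (LinearMap.ker d).subtype) :=
  Submodule.map ((LinearMap.range d).comap (LinearMap.ker d).subtype).mkQ
    ((LinearMap.ker d ⊓ F j).comap (LinearMap.ker d).subtype)

section FilteredComplex

variable {R : Type*} [CommRing R] {C : Type*} [AddCommGroup C] [Module R C]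
  {d : C →ₗ[R] C} {F : ℤ → Submodule R C}

theorem Zrk_eq_ker_inf {r k : ℤ} (h : F (k - r) = ⊥) :
    Zrk d F r k = LinearMap.ker d ⊓ F k := by
  rw [Zrk, h, Submodule.comap_bot, inf_comm]

theorem Brk_eq_range_inf {r k : ℤ} (h : F (k + r) = ⊤) :
    Brk d F r k = LinearMap.range d ⊓ F k := by
  rw [Brk, h, Submodule.map_top, inf_comm]

theorem mk_mem_Gfil_iff {j : ℤ} {x : LinearMap.ker d} :
    ((LinearMap.range d).comap (LinearMap.ker d).subtype).mkQ x ∈ Gfil d F j ↔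
      ∃ y ∈ LinearMap.ker d ⊓ F j, y - (x : C) ∈ LinearMap.range d := by
  constructor
  · rintro ⟨y, hy, hyx⟩
    exact ⟨y, hy,
      (Submodule.Quotient.eq ((LinearMap.range d).comap (LinearMap.ker d).subtype)).1 hyx⟩
  · rintro ⟨y, hy, hyx⟩
    exact ⟨⟨y, hy.1⟩, hy, (Submodule.Quotient.eq _).2 hyx⟩

variable (d F) in
/-- The map `ker d ∩ F^k → 𝒢^k` sending a cycle to its homology class. -/
def cyclesToGfil (k : ℤ) : ↥(LinearMap.ker d ⊓ F k) →ₗ[R] ↥(Gfil d F k) :=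
  (((LinearMap.range d).comap (LinearMap.ker d).subtype).mkQ ∘ₗ
    Submodule.inclusion inf_le_left).codRestrict (Gfil d F k) fun x =>
      ⟨Submodule.inclusion inf_le_left x, x.2, rfl⟩

theorem cyclesToGfil_surjective (k : ℤ) : Function.Surjective (cyclesToGfil d F k) := by
  rintro ⟨_, y, hy, rfl⟩
  exact ⟨⟨y, hy⟩, rfl⟩

theorem comap_cyclesToGfil (hmono : Monotone F) {j k : ℤ} (hjk : j ≤ k) :
    ((Gfil d F j).comap (Gfil d F k).subtype).comap (cyclesToGfil d F k) =
      ((LinearMap.ker d ⊓ F j) ⊔ (LinearMap.range d ⊓ F k)).comap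
        (LinearMap.ker d ⊓ F k).subtype := by
  ext x
  refine (mk_mem_Gfil_iff (x := Submodule.inclusion inf_le_left x)).trans ?_
  rw [Submodule.mem_comap, Submodule.mem_sup]
  constructor
  · rintro ⟨y, hy, hyx⟩
    refine ⟨y, hy, x - y, ⟨?_, sub_mem x.2.2 (hmono hjk hy.2)⟩, add_sub_cancel _ _⟩
    simpa using neg_mem hyx
  · rintro ⟨y, hy, z, hz, hyz⟩
    refine ⟨y, hy, ?_⟩
    have : y - (x : C) = -z := by
      rw [← Submodule.subtype_apply, ← hyz]; abel
    exact this ▸ neg_mem hz.1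

/-- The stable page is the associated graded module of the filtration `𝒢`. -/
theorem nonempty_stablePage_equiv (hmono : Monotone F) {j k : ℤ}
    (hjk : j ≤ k) :
    Nonempty
      ((↥(LinearMap.ker d ⊓ F k) ⧸
          ((LinearMap.ker d ⊓ F j) ⊔ (LinearMap.range d ⊓ F k)).comap
            (LinearMap.ker d ⊓ F k).subtype) ≃ₗ[R]
        (↥(Gfil d F k) ⧸ (Gfil d F j).comap (Gfil d F k).subtype)) := by
  let f := ((Gfil d F j).comap (Gfil d F k).subtype).mkQ ∘ₗ cyclesToGfil d F k
  have hf : Function.Surjective f :=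
    (Submodule.mkQ_surjective _).comp (cyclesToGfil_surjective k)
  have hker : LinearMap.ker f =
      ((LinearMap.ker d ⊓ F j) ⊔ (LinearMap.range d ⊓ F k)).comap
        (LinearMap.ker d ⊓ F k).subtype := by
    rw [LinearMap.ker_comp, Submodule.ker_mkQ, comap_cyclesToGfil hmono hjk]
  exact ⟨(Submodule.quotEquivOfEq _ _ hker.symm).trans (f.quotKerEquivOfSurjective hf)⟩

end FilteredComplex

/-- For a filtered complex with finite filtration (`F^k = 0` for
`k < a`, `F^k = C` for `k ≥ b`) and any `r > max (k - a) (b - k)`, one has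
`Z_r^k = Z^k := ker d ∩ F^k` and `Z_{r-1}^{k-1} + B_{r-1}^k = Z^{k-1} + B^k` where
`B^k := range d ∩ F^k`; so `E_r^k` equals the stable page `Z^k / (Z^{k-1} + B^k)`,
which is isomorphic to `𝒢^k / 𝒢^{k-1}` for the induced filtration `𝒢` on total
homology. -/
theorem stmt4 {R : Type*} [CommRing R] {C : Type*} [AddCommGroup C] [Module R C]
    (d : C →ₗ[R] C) (F : ℤ → Submodule R C)
    (hd : d ∘ₗ d = 0) (hmono : Monotone F) (hdF : ∀ k, (F k).map d ≤ F k)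
    (a b : ℤ) (hab : a ≤ b)
    (hbot : ∀ k : ℤ, k < a → F k = ⊥) (htop : ∀ k : ℤ, b ≤ k → F k = ⊤)
    (k : ℤ) :
    ∀ r : ℤ, max (k - a) (b - k) < r →
      Zrk d F r k = LinearMap.ker d ⊓ F k ∧
      Drk d F r k = (LinearMap.ker d ⊓ F (k - 1)) ⊔ (LinearMap.range d ⊓ F k) ∧
      Nonempty
        ((↥(LinearMap.ker d ⊓ F k) ⧸
            ((LinearMap.ker d ⊓ F (k - 1)) ⊔ (LinearMap.range d ⊓ F k)).comap
              (LinearMap.ker d ⊓ F k).subtype) ≃ₗ[R]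
          (↥(Gfil d F k) ⧸ (Gfil d F (k - 1)).comap (Gfil d F k).subtype)) := by
  intro r hr
  obtain ⟨hra, hrb⟩ := max_lt_iff.1 hr
  refine ⟨Zrk_eq_ker_inf (hbot _ (by omega)), ?_,
    nonempty_stablePage_equiv hmono (sub_one_lt k).le⟩
  rw [Drk, Zrk_eq_ker_inf (hbot _ (by omega)), Brk_eq_range_inf (htop _ (by omega))]
end

section
/- Let (C, d) be a chain complex over a commutative ring R with C a finitely generated R-module, and let F and F′ be two finite d-invariant filtrations of C that are close in the sense that F′^k ⊆ F^k ⊆ F′^{k+1} for every integer k (equivalently, the associated filtration degree functions p and p′ satisfy p′(x) − p(x) ∈ {0, 1} for all x). Let r be an integer. If the spectral sequence associated to F′ has collapsed by page r − 1, then the spectral sequence associated to F has collapsed by page r; that is, the F-spectral sequence collapses at most one page after the F′-spectral sequence does. -/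
/-- The spectral sequence of the filtered complex `(C, d, F)` has collapsed by page `l`:
for every `s ≥ l` and every `k`, `d` maps `Z_s^k` into `Z_{s-1}^{k-s-1} + B_{s-1}^{k-s}`,
i.e. the induced differential `d_s` on the page `E_s` vanishes. -/
def CollapsedBy {R : Type*} [CommRing R] {C : Type*} [AddCommGroup C] [Module R C]
    (d : C →ₗ[R] C) (F : ℤ → Submodule R C) (l : ℤ) : Prop :=
  ∀ s : ℤ, l ≤ s → ∀ k : ℤ,
    (Zrk d F s k).map d ≤ Zrk d F (s - 1) (k - s - 1) ⊔ Brk d F (s - 1) (k - s)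

/-- If a filtration that is bounded below has collapsed by page `l`, then a boundary `d x` with
`x ∈ F^k` and `d x ∈ F^{k-s}`, `s ≥ l`, is already the boundary of an element of `F^{k-1}`. -/
theorem CollapsedBy.mem_map_sub_one {R : Type*} [CommRing R] {C : Type*} [AddCommGroup C]
    [Module R C] {d : C →ₗ[R] C} {F : ℤ → Submodule R C} {l a : ℤ} (hF : CollapsedBy d F l)
    (hmono : Monotone F) (hbot : ∀ k : ℤ, k < a → F k = ⊥) {s k : ℤ} (hs : l ≤ s) {x : C}
    (hx : x ∈ F k) (hdx : d x ∈ F (k - s)) : d x ∈ (F (k - 1)).map d := by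
  obtain ⟨n, hn⟩ : ∃ n : ℕ, k - s < a + n := ⟨(k - s - a + 1).toNat, by omega⟩
  induction n generalizing s x with
  | zero =>
    rw [hbot _ (by omega), Submodule.mem_bot] at hdx
    rw [hdx]
    exact zero_mem _
  | succ n ih =>
    obtain ⟨z, hz, w, hw, hzw⟩ := Submodule.mem_sup.1
      (hF s hs k (Submodule.mem_map_of_mem (show x ∈ Zrk d F s k from ⟨hx, hdx⟩)))
    obtain ⟨y, hy, rfl⟩ := hw.2
    have hy : y ∈ F (k - 1) := hmono (by omega) hy
    have hxy : d (x - y) = z := by rw [map_sub, ← hzw, add_sub_cancel_right]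
    have hz' : d (x - y) ∈ F (k - (s + 1)) := by
      rw [hxy]
      exact hmono (by omega) hz.1
    have h := ih (by omega) (sub_mem hx (hmono (by omega) hy)) hz' (by push_cast at hn; omega)
    rw [hxy] at h
    rw [← hzw]
    exact add_mem h (Submodule.mem_map_of_mem hy)

/-- If a finite filtration has collapsed by page `l`, then every boundary in `F^j` is the boundary
of an element of `F^{j+l-1}`. -/
theorem CollapsedBy.mem_map_of_mem_range {R : Type*} [CommRing R] {C : Type*} [AddCommGroup C]
    [Module R C] {d : C →ₗ[R] C} {F : ℤ → Submodule R C} {l a b : ℤ} (hF : CollapsedBy d F l)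
    (hmono : Monotone F) (hbot : ∀ k : ℤ, k < a → F k = ⊥) (htop : ∀ k : ℤ, b ≤ k → F k = ⊤)
    {j : ℤ} {x : C} (hdx : d x ∈ F j) : d x ∈ (F (j + l - 1)).map d := by
  have descend (n : ℕ) : ∀ y, y ∈ F (j + l - 1 + n) → d y ∈ F j →
      d y ∈ (F (j + l - 1)).map d := by
    induction n with
    | zero =>
      intro y hy _
      exact Submodule.mem_map_of_mem (by simpa using hy)
    | succ n ih =>
      intro y hy hdy
      obtain ⟨y', hy', hyy'⟩ := hF.mem_map_sub_one hmono hbot (s := l + n)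
        (by omega) hy (hmono (by push_cast; omega) hdy)
      rw [← hyy'] at hdy ⊢
      exact ih y' (hmono (by push_cast; omega) hy') hdy
  refine descend (b - (j + l - 1)).toNat x ?_ hdx
  rw [htop _ (by omega)]
  exact Submodule.mem_top

/-- Let `C` be a finitely generated module with differential `d`, and
`F`, `F'` two finite `d`-invariant filtrations that are close: `F'^k ⊆ F^k ⊆ F'^{k+1}`
for all `k`. If the `F'`-spectral sequence has collapsed by page `r - 1`, then the
`F`-spectral sequence has collapsed by page `r`. -/
theorem stmt6 {R : Type*} [CommRing R] {C : Type*} [AddCommGroup C] [Module R C]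
    [Module.Finite R C]
    (d : C →ₗ[R] C) (hd : d ∘ₗ d = 0)
    (F F' : ℤ → Submodule R C) (hmono : Monotone F) (hmono' : Monotone F')
    (hdF : ∀ k, (F k).map d ≤ F k) (hdF' : ∀ k, (F' k).map d ≤ F' k)
    (a b : ℤ) (hab : a ≤ b)
    (hbot : ∀ k : ℤ, k < a → F k = ⊥) (htop : ∀ k : ℤ, b ≤ k → F k = ⊤)
    (hbot' : ∀ k : ℤ, k < a → F' k = ⊥) (htop' : ∀ k : ℤ, b ≤ k → F' k = ⊤)
    (hclose : ∀ k : ℤ, F' k ≤ F k ∧ F k ≤ F' (k + 1))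
    (r : ℤ) (hcollapsed : CollapsedBy d F' (r - 1)) :
    CollapsedBy d F r := by
  rintro s hs k _ ⟨x, ⟨_, hdx⟩, rfl⟩
  have hdx : d x ∈ F (k - s) := hdx
  refine Submodule.mem_sup_right ⟨hdx, ?_⟩
  refine Submodule.map_mono ?_
    (hcollapsed.mem_map_of_mem_range hmono' hbot' htop' ((hclose _).2 hdx))
  exact (hclose _).1.trans (hmono (by omega))
end

section
/- Let F₂ be the field with two elements, let m be a natural number, and let A_m = A_m(F₂) = F₂[X₁,…,X_m]/(X₁²,…,X_m²). Let 𝔽 be a field of characteristic 2 (viewed as an F₂-algebra), and let M be an A_m-module. If the base change 𝔽 ⊗_{F₂} M, viewed as a module over 𝔽 ⊗_{F₂} A_m ≅ A_m(𝔽), is a free module of rank one, then M is a free A_m-module of rank one. -/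
noncomputable section

open TensorProduct

/-- The ideal `(X₁², …, X_m²)` of `K[X₁, …, X_m]`. -/
def sqIdeal (K : Type*) [CommRing K] (m : ℕ) : Ideal (MvPolynomial (Fin m) K) :=
  Ideal.span (Set.range fun i : Fin m => MvPolynomial.X i ^ 2)

/-- The algebra `A_m(K) = K[X₁, …, X_m]/(X₁², …, X_m²)`. -/
abbrev Am (K : Type*) [CommRing K] (m : ℕ) : Type _ :=
  MvPolynomial (Fin m) K ⧸ sqIdeal K m

/-- The `A_m`-algebra structure on the base change `𝔽 ⊗_{F₂} A_m`
(`A_m` acting through the right tensor factor). -/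
local instance amRightAlgebra (m : ℕ) (𝔽 : Type*) [Field 𝔽] [Algebra (ZMod 2) 𝔽] :
    Algebra (Am (ZMod 2) m) (𝔽 ⊗[ZMod 2] Am (ZMod 2) m) :=
  Algebra.TensorProduct.rightAlgebra

local instance amRightModule (m : ℕ) (𝔽 : Type*) [Field 𝔽] [Algebra (ZMod 2) 𝔽] :
    Module (Am (ZMod 2) m) (𝔽 ⊗[ZMod 2] Am (ZMod 2) m) :=
  (amRightAlgebra m 𝔽).toModule

theorem Am.isNilpotent_mk_X (K : Type*) [CommRing K] (m : ℕ) (i : Fin m) :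
    IsNilpotent (Ideal.Quotient.mk (sqIdeal K m) (MvPolynomial.X i)) :=
  ⟨2, by
    rw [← map_pow, Ideal.Quotient.eq_zero_iff_mem]
    exact Ideal.subset_span ⟨i, rfl⟩⟩

theorem Am.isNilpotent_mk_sub_C (K : Type*) [CommRing K] (m : ℕ)
    (p : MvPolynomial (Fin m) K) :
    IsNilpotent (Ideal.Quotient.mk (sqIdeal K m)
      (p - MvPolynomial.C (MvPolynomial.constantCoeff p))) := by
  induction p using MvPolynomial.induction_on with
  | C a => simp
  | add p q hp hq =>
    rw [map_add, map_add, add_sub_add_comm, map_add]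
    exact (Commute.all _ _).isNilpotent_add hp hq
  | mul_X p i _ =>
    simpa using (Commute.all _ _).isNilpotent_mul_left (Am.isNilpotent_mk_X K m i)

/-- The augmentation `A_m(K) → K` sending every variable to `0`. -/
def Am.augmentation (K : Type*) [CommRing K] (m : ℕ) : Am K m →+* K :=
  Ideal.Quotient.lift (sqIdeal K m) MvPolynomial.constantCoeff fun p hp => by
    have hle : sqIdeal K m ≤ RingHom.ker (MvPolynomial.constantCoeff (σ := Fin m) (R := K)) := by
      rw [sqIdeal, Ideal.span_le]
      rintro _ ⟨i, rfl⟩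
      simp [RingHom.mem_ker]
    exact hle hp

instance Am.isLocalHom_augmentation (K : Type*) [CommRing K] (m : ℕ) :
    IsLocalHom (Am.augmentation K m) where
  map_nonunit a ha := by
    obtain ⟨p, rfl⟩ := Ideal.Quotient.mk_surjective a
    have hc : IsUnit (MvPolynomial.constantCoeff p) := ha
    have hu := (hc.map (MvPolynomial.C (σ := Fin m))).map (Ideal.Quotient.mk (sqIdeal K m))
    simpa using
      (Am.isNilpotent_mk_sub_C K m p).isUnit_add_left_of_commute hu (Commute.all _ _)

instance Am.isLocalRing (K : Type*) [CommRing K] [IsLocalRing K] (m : ℕ) :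
    IsLocalRing (Am K m) :=
  (Am.augmentation K m).domain_isLocalRing

/-- Freeness of rank one descends along faithfully flat extensions of a local ring. -/
theorem free_and_rank_eq_one_of_baseChange (R S M : Type*) [CommRing R] [IsLocalRing R]
    [CommRing S] [Algebra R S] [Module.FaithfullyFlat R S] [AddCommGroup M] [Module R M]
    (hfree : Module.Free S (S ⊗[R] M)) (hrank : Module.rank S (S ⊗[R] M) = 1) :
    Module.Free R M ∧ Module.rank R M = 1 := by
  have : Nontrivial S := (TensorProduct.rid R S).symm.toEquiv.nontrivial
  have : Module.Finite S (S ⊗[R] M) := Module.finite_of_rank_eq_one hrank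
  have : Module.Finite R M := .of_finite_tensorProduct_of_faithfullyFlat S
  have : Module.Flat R M := .of_flat_tensorProduct R M S
  have hM : Module.Free R M := Module.free_of_flat_of_isLocalRing
  refine ⟨hM, ?_⟩
  have h := Module.finrank_baseChange (R := S) (S := R) (M' := M)
  rw [Module.finrank_eq_of_rank_eq hrank] at h
  rw [← Module.finrank_eq_rank, ← h, Nat.cast_one]

instance faithfullyFlat_amRightAlgebra (m : ℕ) (𝔽 : Type*) [Field 𝔽] [Algebra (ZMod 2) 𝔽] :
    Module.FaithfullyFlat (Am (ZMod 2) m) (𝔽 ⊗[ZMod 2] Am (ZMod 2) m) :=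
  .of_linearEquiv (Am (ZMod 2) m) (Am (ZMod 2) m ⊗[ZMod 2] 𝔽)
    (Algebra.TensorProduct.commRight (ZMod 2) (Am (ZMod 2) m) 𝔽).symm.toLinearEquiv

/-- Let `A_m = F₂[X₁,…,X_m]/(X₁²,…,X_m²)` (with `F₂ = ZMod 2`), let `𝔽`
be a field of characteristic `2` viewed as an `F₂`-algebra, and let `M` be an
`A_m`-module.  If the base change `𝔽 ⊗_{F₂} M = (𝔽 ⊗_{F₂} A_m) ⊗_{A_m} M`, viewed as a
module over `𝔽 ⊗_{F₂} A_m ≅ A_m(𝔽)`, is a free module of rank one, then `M` is a free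
`A_m`-module of rank one. -/
theorem stmt9 (m : ℕ) (𝔽 : Type*) [Field 𝔽] [CharP 𝔽 2] [Algebra (ZMod 2) 𝔽]
    (M : Type*) [AddCommGroup M] [Module (Am (ZMod 2) m) M]
    (hfree : Module.Free (𝔽 ⊗[ZMod 2] Am (ZMod 2) m)
      ((𝔽 ⊗[ZMod 2] Am (ZMod 2) m) ⊗[Am (ZMod 2) m] M))
    (hrank : Module.rank (𝔽 ⊗[ZMod 2] Am (ZMod 2) m)
      ((𝔽 ⊗[ZMod 2] Am (ZMod 2) m) ⊗[Am (ZMod 2) m] M) = 1) :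
    Module.Free (Am (ZMod 2) m) M ∧ Module.rank (Am (ZMod 2) m) M = 1 :=
  free_and_rank_eq_one_of_baseChange (Am (ZMod 2) m) (𝔽 ⊗[ZMod 2] Am (ZMod 2) m) M hfree hrank
end
end
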